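/- Let q be an odd prime power with q ≡ 3 (mod 8) and let m ≥ 2. Then the group algebra F_q[C_{2^m}] of the cyclic group of order 2^m decomposes as a direct sum of exactly 2m − 1 fields. -/

import Mathlib

open Polynomial in
theorem FiniteField.natCard_pow_card_eq_self (F K : Type*) [Field F] [Fintype F] [Field K]
    [Algebra F K] :
    Nat.card {x : K // x ^ Fintype.card F = x} = Fintype.card F := by
  refine (Eq.symm ?_).trans (Nat.card_eq_fintype_card (α := F))
  refine Nat.card_eq_of_bijective
    (fun a : F => (⟨algebraMap F K a, by rw [← map_pow, FiniteField.pow_card]⟩ :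
      {x : K // x ^ Fintype.card F = x})) ⟨fun a b h => ?_, fun ⟨x, hx⟩ => ?_⟩
  · exact (algebraMap F K).injective (Subtype.ext_iff.mp h)
  · have h : (X ^ Fintype.card F - X : F[X]).Splits := by
      rw [splits_iff_card_roots, FiniteField.roots_X_pow_card_sub_X, ← Finset.card_def,
        Finset.card_univ, FiniteField.X_pow_card_sub_X_natDegree_eq _ Fintype.one_lt_card]
    have hr := h.roots_map (algebraMap F K)
    have hmem : x ∈ ((X ^ Fintype.card F - X : F[X]).map (algebraMap F K)).roots := by
      simp [hx, FiniteField.X_pow_card_sub_X_ne_zero K Fintype.one_lt_card]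
    rw [hr, Multiset.mem_map] at hmem
    obtain ⟨a, -, ha⟩ := hmem
    exact ⟨a, Subtype.ext ha⟩

/-- The fixed points of the `q`-Frobenius of a finite reduced commutative `F_q`-algebra count its
maximal ideals. -/
theorem natCard_pow_card_eq_self_of_isReduced (F A : Type*) [Field F] [Fintype F] [CommRing A]
    [Algebra F A] [IsArtinianRing A] [IsReduced A] :
    Nat.card {x : A // x ^ Fintype.card F = x} =
      Fintype.card F ^ Nat.card (MaximalSpectrum A) := by
  have := Fintype.ofFinite (MaximalSpectrum A)
  let e := IsArtinianRing.equivPi A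
  have e' : {x : A // x ^ Fintype.card F = x} ≃
      ∀ M : MaximalSpectrum A, {y : A ⧸ M.asIdeal // y ^ Fintype.card F = y} :=
    (e.toEquiv.subtypeEquiv (q := fun y => ∀ M, y M ^ Fintype.card F = y M) fun x => by
      rw [← e.injective.eq_iff, map_pow, funext_iff]
      rfl).trans
      (Equiv.subtypePiEquivPi (p := fun {M : MaximalSpectrum A} (y : A ⧸ M.asIdeal) => y ^ Fintype.card F = y))
  rw [Nat.card_congr e', Nat.card_pi]
  have h (M : MaximalSpectrum A) :
      Nat.card {y : A ⧸ M.asIdeal // y ^ Fintype.card F = y} = Fintype.card F := by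
    let _ : Field (A ⧸ M.asIdeal) := Ideal.Quotient.field M.asIdeal
    exact FiniteField.natCard_pow_card_eq_self F (A ⧸ M.asIdeal)
  simp [h]

theorem MonoidAlgebra.pow_card_eq_mapDomain {F G : Type*} [Field F] [Fintype F] [CommGroup G]
    (x : MonoidAlgebra F G) :
    x ^ Fintype.card F = MonoidAlgebra.mapDomain (· ^ Fintype.card F) x := by
  have h : FiniteField.frobeniusAlgHom F (MonoidAlgebra F G) =
      MonoidAlgebra.mapDomainAlgHom F F (powMonoidHom (α := G) (Fintype.card F)) := by
    refine MonoidAlgebra.algHom_ext (fun g => ?_) (Subsingleton.elim _ _)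
    simp [MonoidAlgebra.single_pow]
  exact DFunLike.congr_fun h x

theorem MonoidAlgebra.isReduced_of_coprime_card {F G : Type*} [Field F] [Fintype F] [CommGroup G]
    (h : (Nat.card G).Coprime (Fintype.card F)) : IsReduced (MonoidAlgebra F G) := by
  refine (isReduced_iff_pow_one_lt (Fintype.card F) Fintype.one_lt_card).mpr fun x hx => ?_
  rw [MonoidAlgebra.pow_card_eq_mapDomain] at hx
  refine MonoidAlgebra.mapDomain_injective (powCoprime h).injective ?_
  rw [MonoidAlgebra.mapDomain_zero]
  exact hx

theorem MonoidAlgebra.pow_card_eq_self_iff {F G : Type*} [Field F] [Fintype F] [CommGroup G]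
    (h : (Nat.card G).Coprime (Fintype.card F)) (x : MonoidAlgebra F G) :
    x ^ Fintype.card F = x ↔ ∀ g, x.coeff (g ^ Fintype.card F) = x.coeff g := by
  have key (g : G) : (x ^ Fintype.card F).coeff (g ^ Fintype.card F) = x.coeff g := by
    rw [MonoidAlgebra.pow_card_eq_mapDomain]
    exact Finsupp.mapDomain_apply (powCoprime h).injective x.coeff g
  refine ⟨fun hx g => by rw [← key g, hx], fun hx => ?_⟩
  ext g
  obtain ⟨g, rfl⟩ := (powCoprime h).surjective g
  exact (key g).trans (hx g).symm

/-- The functions on `ℤ` that are `n`-periodic and invariant under multiplication by `q`. -/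
abbrev PeriodicMulInvariant (α : Type*) (q : ℕ) (n : ℕ) : Type _ :=
  {a : ℤ → α // Function.Periodic a n ∧ ∀ x, a (q * x) = a x}

theorem MonoidAlgebra.natCard_pow_card_eq_self_zmod (F : Type*) [Field F] [Fintype F] (n : ℕ)
    [NeZero n] (h : n.Coprime (Fintype.card F)) :
    Nat.card {x : MonoidAlgebra F (Multiplicative (ZMod n)) // x ^ Fintype.card F = x} =
      Nat.card (PeriodicMulInvariant F (Fintype.card F) n) := by
  have hG : (Nat.card (Multiplicative (ZMod n))).Coprime (Fintype.card F) := by simpa using h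
  refine Nat.card_eq_of_bijective (fun x => ⟨fun k => x.1.coeff (.ofAdd (k : ZMod n)),
    fun k => by simp, fun k => ?_⟩) ⟨fun x y hxy => ?_, fun ⟨a, ha, ha'⟩ => ?_⟩
  · beta_reduce
    rw [← (MonoidAlgebra.pow_card_eq_self_iff hG x.1).mp x.2 (.ofAdd (k : ZMod n)), ← ofAdd_nsmul]
    simp
  · ext g
    obtain ⟨k, hk⟩ := ZMod.intCast_surjective g.toAdd
    have := congrFun (Subtype.ext_iff.mp hxy) k
    simpa [hk] using this
  · have hcast (k : ℤ) : a ((k : ZMod n).cast) = a k := by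
      rw [ZMod.coe_intCast, Int.emod_def, mul_comm]
      exact ha.sub_int_mul_eq _
    refine ⟨⟨.ofCoeff (Finsupp.equivFunOnFinite.symm fun g => a (g.toAdd.cast)),
      (MonoidAlgebra.pow_card_eq_self_iff hG _).mpr fun g => ?_⟩,
      Subtype.ext <| funext fun k => ?_⟩
    · obtain ⟨k, hk⟩ := ZMod.intCast_surjective g.toAdd
      have := hcast (Fintype.card F * k)
      rw [ha', ← hcast k] at this
      simpa [← hk] using this
    · simpa using hcast k

theorem exists_pow_two_pow_eq {q : ℤ} (hq : q % 8 = 3) (j : ℕ) :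
    ∃ t, q ^ 2 ^ (j + 1) = 1 + 2 ^ (j + 3) * (2 * t + 1) := by
  induction j with
  | zero =>
    obtain ⟨s, rfl⟩ : ∃ s, q = 8 * s + 3 := ⟨q / 8, by omega⟩
    exact ⟨4 * s ^ 2 + 3 * s, by ring⟩
  | succ j ih =>
    obtain ⟨t, ht⟩ := ih
    refine ⟨t + 2 ^ (j + 1) * (2 * t + 1) ^ 2, ?_⟩
    rw [pow_succ 2 (j + 1), pow_mul, ht]
    ring

theorem exists_two_pow_dvd_pow_sub {q : ℤ} (hq : q % 8 = 3) (k : ℕ) {w : ℤ}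
    (hw : w % 8 = 1 ∨ w % 8 = 3) : ∃ i : ℕ, 2 ^ (k + 3) ∣ q ^ i - w := by
  induction k with
  | zero =>
    rcases hw with hw | hw
    · exact ⟨0, by norm_num; omega⟩
    · exact ⟨1, by norm_num; omega⟩
  | succ k ih =>
    obtain ⟨i, c, hc⟩ := ih
    obtain ⟨d, rfl | rfl⟩ := Int.even_or_odd' c
    · exact ⟨i, d, by rw [hc]; ring⟩
    · obtain ⟨t, ht⟩ := exists_pow_two_pow_eq hq k
      have hodd : Odd (q ^ i) := Odd.pow (Int.odd_iff.mpr (by omega))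
      obtain ⟨s, hs⟩ := hodd
      refine ⟨i + 2 ^ (k + 1), d + t * q ^ i + s + 1, ?_⟩
      rw [pow_add, ht]
      linear_combination hc + 2 ^ (k + 3) * hs

namespace PeriodicMulInvariant

variable {α : Type*} {q : ℕ}

theorem apply_pow_mul {n : ℕ} (a : PeriodicMulInvariant α q n) (i : ℕ) (x : ℤ) :
    a.1 (q ^ i * x) = a.1 x := by
  induction i with
  | zero => simp
  | succ i ih => rw [pow_succ', mul_assoc, a.2.2, ih]

theorem apply_eq_of_dvd_sub {n : ℕ} (a : PeriodicMulInvariant α q n) {x y : ℤ}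
    (h : (n : ℤ) ∣ x - y) : a.1 x = a.1 y := by
  obtain ⟨c, hc⟩ := h
  rw [show x = y + c * n by linear_combination hc]
  exact a.2.1.int_mul c y

theorem apply_eq_one (hq : q % 8 = 3) {k : ℕ} (a : PeriodicMulInvariant α q (2 ^ (k + 3)))
    {x : ℤ} (hx : x % 8 = 1 ∨ x % 8 = 3) : a.1 x = a.1 1 := by
  obtain ⟨i, hi⟩ := exists_two_pow_dvd_pow_sub (q := q) (by omega) k hx
  rw [← a.apply_pow_mul i 1, mul_one]
  exact (a.apply_eq_of_dvd_sub (by exact_mod_cast hi)).symm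

theorem apply_eq_neg_one (hq : q % 8 = 3) {k : ℕ} (a : PeriodicMulInvariant α q (2 ^ (k + 3)))
    {x : ℤ} (hx : x % 8 = 5 ∨ x % 8 = 7) : a.1 x = a.1 (-1) := by
  obtain ⟨i, hi⟩ := exists_two_pow_dvd_pow_sub (q := q) (w := -x) (by omega) k (by omega)
  rw [← a.apply_pow_mul i (-1)]
  refine a.apply_eq_of_dvd_sub ?_
  push_cast
  convert hi using 1
  ring

theorem natCard_four (hq : q % 8 = 3) :
    Nat.card (PeriodicMulInvariant α q 4) = Nat.card α ^ 3 := by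
  have hq4 (x : ℤ) : (q * x) % 4 = (3 * x) % 4 := by
    rw [Int.mul_emod, show (q : ℤ) % 4 = 3 by omega]
    omega
  rw [show Nat.card α ^ 3 = Nat.card (α × α × α) by rw [Nat.card_prod, Nat.card_prod]; ring]
  refine Nat.card_eq_of_bijective (fun a => (a.1 0, a.1 1, a.1 2))
    ⟨fun a b h => ?_, fun ⟨u, v, w⟩ => ?_⟩
  · have h3 (a : PeriodicMulInvariant α q 4) : a.1 3 = a.1 1 := by
      rw [← a.2.2 1]
      exact a.apply_eq_of_dvd_sub (by push_cast; omega)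
    simp only [Prod.mk.injEq] at h
    obtain ⟨h0, h1, h2⟩ := h
    ext x
    have hmod (a : PeriodicMulInvariant α q 4) : a.1 x = a.1 (x % 4) :=
      a.apply_eq_of_dvd_sub (by push_cast; omega)
    rw [hmod a, hmod b]
    obtain hx | hx | hx | hx : x % 4 = 0 ∨ x % 4 = 1 ∨ x % 4 = 2 ∨ x % 4 = 3 := by omega
    all_goals simp [hx, h0, h1, h2, h3]
  · refine ⟨⟨fun x => if x % 4 = 0 then u else if x % 4 = 2 then w else v,
      fun x => by simp, fun x => ?_⟩, by simp⟩
    have := hq4 x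
    have h0 : (q * x) % 4 = 0 ↔ x % 4 = 0 := by omega
    have h2 : (q * x) % 4 = 2 ↔ x % 4 = 2 := by omega
    simp only [h0, h2]

theorem natCard_two_pow_succ (hq : q % 8 = 3) (k : ℕ) :
    Nat.card (PeriodicMulInvariant α q (2 ^ (k + 3))) =
      Nat.card (PeriodicMulInvariant α q (2 ^ (k + 2))) * Nat.card α ^ 2 := by
  rw [sq, ← Nat.card_prod α α, ← Nat.card_prod]
  refine Nat.card_eq_of_bijective (fun a => (⟨fun x => a.1 (2 * x), fun x => ?_, fun x => ?_⟩,
    a.1 1, a.1 (-1))) ⟨fun a b h => ?_, fun ⟨⟨b, hb, hb'⟩, u, v⟩ => ?_⟩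
  · exact a.apply_eq_of_dvd_sub ⟨1, by push_cast; ring⟩
  · beta_reduce
    rw [mul_left_comm]
    exact a.2.2 _
  · simp only [Prod.mk.injEq, Subtype.mk.injEq] at h
    obtain ⟨h0, h1, h2⟩ := h
    ext x
    obtain ⟨y, rfl⟩ | hx | hx :
        (∃ y, x = 2 * y) ∨ (x % 8 = 1 ∨ x % 8 = 3) ∨ (x % 8 = 5 ∨ x % 8 = 7) := by
      by_cases h : x % 2 = 0
      · exact .inl ⟨x / 2, by omega⟩
      · omega
    · exact congrFun h0 y
    · rw [a.apply_eq_one hq hx, b.apply_eq_one hq hx, h1]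
    · rw [a.apply_eq_neg_one hq hx, b.apply_eq_neg_one hq hx, h2]
  · have hq8 (x : ℤ) : (q * x) % 8 = (3 * x) % 8 := by
      rw [Int.mul_emod, show (q : ℤ) % 8 = 3 by omega]
      omega
    refine ⟨⟨fun x => if x % 2 = 0 then b (x / 2) else
      if x % 8 = 1 ∨ x % 8 = 3 then u else v, fun x => ?_, fun x => ?_⟩, by simp⟩
    · have hpow : ((2 ^ (k + 3) : ℕ) : ℤ) = 8 * 2 ^ k := by push_cast; ring
      have hhalf : (x + 8 * 2 ^ k) / 2 = x / 2 + (2 ^ (k + 2) : ℕ) := by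
        push_cast
        rw [pow_add]
        omega
      have h2 : (x + 8 * 2 ^ k) % 2 = x % 2 := by omega
      have h8 : (x + 8 * 2 ^ k) % 8 = x % 8 := by omega
      simp only [hpow, hhalf, h2, h8, hb (x / 2)]
    · have := hq8 x
      have h2 : (q * x) % 2 = 0 ↔ x % 2 = 0 := by omega
      have h8 : x % 2 ≠ 0 →
          (((q * x) % 8 = 1 ∨ (q * x) % 8 = 3) ↔ (x % 8 = 1 ∨ x % 8 = 3)) := by omega
      by_cases hx : x % 2 = 0
      · simp only [h2, hx, if_true]
        rw [Int.mul_ediv_assoc _ (by omega), hb']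
      · simp only [h2, hx, if_false, h8 hx]

theorem natCard_two_pow (hq : q % 8 = 3) (k : ℕ) :
    Nat.card (PeriodicMulInvariant α q (2 ^ (k + 2))) = Nat.card α ^ (2 * k + 3) := by
  induction k with
  | zero => exact natCard_four hq
  | succ k ih => rw [natCard_two_pow_succ hq, ih, ← pow_add]; congr 1

end PeriodicMulInvariant

set_option synthInstance.maxHeartbeats 1000000 in

/-- Let `q` be an odd prime power with `q ≡ 3 (mod 8)` (so `F` is the field of `q`
elements) and let `m ≥ 2`.  Then the group algebra `F_q[C_{2^m}]` decomposes as a direct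
sum of exactly `2m - 1` fields: it has exactly `2m - 1` maximal ideals, it is isomorphic
as a ring to the product of the corresponding residue fields, and each of these residue
rings is a field. -/
theorem group_algebra_cyclic_two_group_decomposition (q m : ℕ) (hm : 2 ≤ m)
    (hq : q % 8 = 3) (F : Type*) [Field F] [Fintype F] (hF : Fintype.card F = q) :
    Nat.card (MaximalSpectrum (MonoidAlgebra F (Multiplicative (ZMod (2 ^ m))))) =
        2 * m - 1 ∧
    (∀ M : MaximalSpectrum (MonoidAlgebra F (Multiplicative (ZMod (2 ^ m)))),
      IsField (MonoidAlgebra F (Multiplicative (ZMod (2 ^ m))) ⧸ M.asIdeal)) ∧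
    Nonempty (MonoidAlgebra F (Multiplicative (ZMod (2 ^ m))) ≃+*
      ∀ M : MaximalSpectrum (MonoidAlgebra F (Multiplicative (ZMod (2 ^ m)))),
        MonoidAlgebra F (Multiplicative (ZMod (2 ^ m))) ⧸ M.asIdeal) := by
  have hcop : (2 ^ m).Coprime (Fintype.card F) :=
    Nat.Coprime.pow_left m (Nat.coprime_two_left.mpr (Nat.odd_iff.mpr (by omega)))
  have : IsReduced (MonoidAlgebra F (Multiplicative (ZMod (2 ^ m)))) :=
    MonoidAlgebra.isReduced_of_coprime_card (by simpa using hcop)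
  have : IsArtinianRing (MonoidAlgebra F (Multiplicative (ZMod (2 ^ m)))) :=
    IsArtinianRing.of_finite F _
  refine ⟨?_, fun M => (Ideal.Quotient.maximal_ideal_iff_isField_quotient _).mp M.isMaximal,
    ⟨(IsArtinianRing.equivPi _).toRingEquiv⟩⟩
  have hcard := natCard_pow_card_eq_self_of_isReduced F
    (MonoidAlgebra F (Multiplicative (ZMod (2 ^ m))))
  obtain ⟨k, rfl⟩ := Nat.exists_eq_add_of_le' hm
  rw [MonoidAlgebra.natCard_pow_card_eq_self_zmod F _ hcop,
    PeriodicMulInvariant.natCard_two_pow (by omega), Nat.card_eq_fintype_card] at hcard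
  have := Nat.pow_right_injective Fintype.one_lt_card hcard
  omega
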